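/- Let K be a compact connected subset of ℝ². Then the limit lim_{ε→0⁺} L(K^ε \ K)/ε exists (possibly infinite) and equals sup_{ε>0} [L(K^ε \ K)/ε − πε]. -/

import Mathlib

open Metric MeasureTheory Set Filter Topology ENNReal

noncomputable abbrev Plane := EuclideanSpace ℝ (Fin 2)

/-- The outer Minkowski content characterized as a supremum:
`SM¹(K) = sup_{ε>0} [L(K^ε \ K)/ε − πε]` (with values in `[0,∞]`). -/
noncomputable def SMsup (K : Set Plane) : ℝ≥0∞ :=
  ⨆ ε ∈ Set.Ioi (0 : ℝ),
    (volume (cthickening ε K \ K) / ENNReal.ofReal ε - ENNReal.ofReal (Real.pi * ε))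

/-! ### Part 1: the Euler characteristic inequality for tiles hit by a connected set -/

/-- closed tiles of the unit grid hit by `C` -/
def tileF (C : Set (ℝ × ℝ)) : Set (ℤ × ℤ) :=
  {g | ∃ p ∈ C, p.1 ∈ Icc (g.1 : ℝ) (g.1 + 1) ∧ p.2 ∈ Icc (g.2 : ℝ) (g.2 + 1)}
/-- horizontal edges hit by `C` -/
def tileH (C : Set (ℝ × ℝ)) : Set (ℤ × ℤ) :=
  {g | ∃ p ∈ C, p.1 ∈ Icc (g.1 : ℝ) (g.1 + 1) ∧ p.2 = g.2}
/-- vertical edges hit by `C` -/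
def tileE (C : Set (ℝ × ℝ)) : Set (ℤ × ℤ) :=
  {g | ∃ p ∈ C, p.1 = g.1 ∧ p.2 ∈ Icc (g.2 : ℝ) (g.2 + 1)}
/-- grid points in `C` -/
def tileV (C : Set (ℝ × ℝ)) : Set (ℤ × ℤ) :=
  {g | ∃ p ∈ C, p.1 = g.1 ∧ p.2 = g.2}

theorem tileF_finite {C : Set (ℝ × ℝ)} (hC : IsCompact C) : (tileF C).Finite := by
  obtain ⟨R, hR⟩ := hC.isBounded.subset_closedBall (0 : ℝ × ℝ)
  apply ((Set.finite_Icc (-(⌈R⌉ + 1)) (⌈R⌉ + 1)).prod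
    (Set.finite_Icc (-(⌈R⌉ + 1)) (⌈R⌉ + 1))).subset
  rintro ⟨m, n⟩ ⟨p, hp, h1, h2⟩
  have hp' := hR hp
  rw [mem_closedBall_zero_iff, Prod.norm_def, max_le_iff, Real.norm_eq_abs, Real.norm_eq_abs,
    abs_le, abs_le] at hp'
  have hc := Int.le_ceil R
  simp only [mem_Icc] at h1 h2
  simp only [Set.mem_prod, mem_Icc]
  obtain ⟨⟨a1, a2⟩, a3, a4⟩ := hp'
  refine ⟨⟨?_, ?_⟩, ?_, ?_⟩ <;>
  · have : ((0 : ℤ) : ℝ) ≤ 0 := by simp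
    rify
    linarith

theorem tileH_sub (C : Set (ℝ × ℝ)) : tileH C ⊆ tileF C := by
  rintro g ⟨p, hp, h1, h2⟩
  exact ⟨p, hp, h1, by rw [h2]; constructor <;> linarith⟩

theorem tileE_sub (C : Set (ℝ × ℝ)) : tileE C ⊆ tileF C := by
  rintro g ⟨p, hp, h1, h2⟩
  exact ⟨p, hp, by rw [h1]; constructor <;> linarith, h2⟩

theorem tileV_sub (C : Set (ℝ × ℝ)) : tileV C ⊆ tileE C := by
  rintro g ⟨p, hp, h1, h2⟩
  exact ⟨p, hp, h1, by rw [h2]; constructor <;> linarith⟩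

theorem tileH_sub' {C : Set (ℝ × ℝ)} {m n : ℤ} (h : (m, n) ∈ tileH C) :
    (m, n - 1) ∈ tileF C := by
  obtain ⟨p, hp, h1, h2⟩ := h
  exact ⟨p, hp, h1, by rw [h2]; push_cast; constructor <;> linarith⟩

theorem tileE_sub' {C : Set (ℝ × ℝ)} {m n : ℤ} (h : (m, n) ∈ tileE C) :
    (m - 1, n) ∈ tileF C := by
  obtain ⟨p, hp, h1, h2⟩ := h
  exact ⟨p, hp, by rw [h1]; push_cast; constructor <;> linarith, h2⟩

theorem tileV_H {C : Set (ℝ × ℝ)} {m n : ℤ} (h : (m, n) ∈ tileV C) :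
    (m, n) ∈ tileH C ∧ (m - 1, n) ∈ tileH C ∧ (m, n - 1) ∈ tileE C := by
  obtain ⟨p, hp, h1, h2⟩ := h
  refine ⟨⟨p, hp, ?_, h2⟩, ⟨p, hp, ?_, h2⟩, ⟨p, hp, h1, ?_⟩⟩
  · rw [h1]; constructor <;> simp
  · rw [h1]; push_cast; constructor <;> linarith
  · rw [h2]; push_cast; constructor <;> linarith

/-- the pruned adjacency graph on the hit tiles -/
def tileG (C : Set (ℝ × ℝ)) : SimpleGraph (tileF C) :=
  SimpleGraph.fromRel (fun a b =>
    ((b : ℤ × ℤ) ∈ tileH C ∧ (a : ℤ × ℤ) = (b.1.1, b.1.2 - 1)) ∨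
    ((b : ℤ × ℤ) ∈ tileE C \ tileV C ∧ (a : ℤ × ℤ) = (b.1.1 - 1, b.1.2)))

theorem tileG_reach_H {C : Set (ℝ × ℝ)} {m n : ℤ} (h : (m, n) ∈ tileH C) :
    (tileG C).Reachable ⟨(m, n - 1), tileH_sub' h⟩ ⟨(m, n), tileH_sub C h⟩ := by
  apply SimpleGraph.Adj.reachable
  rw [tileG, SimpleGraph.fromRel_adj]
  refine ⟨?_, Or.inl (Or.inl ⟨h, rfl⟩)⟩
  simp [Subtype.ext_iff]

theorem tileG_reach_E {C : Set (ℝ × ℝ)} (hC : IsCompact C) {m n : ℤ} (h : (m, n) ∈ tileE C) :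
    (tileG C).Reachable ⟨(m - 1, n), tileE_sub' h⟩ ⟨(m, n), tileE_sub C h⟩ := by
  have hbd : ∃ B : ℤ, ∀ g ∈ tileF C, B ≤ g.2 := by
    obtain ⟨B, hB⟩ := ((tileF_finite hC).image Prod.snd).bddBelow
    exact ⟨B, fun g hg => hB ⟨g, hg, rfl⟩⟩
  obtain ⟨B, hB⟩ := hbd
  obtain ⟨k, hk⟩ : ∃ k : ℕ, n = B + k := ⟨(n - B).toNat, by
    have := hB _ (tileE_sub C h); simp at this; omega⟩
  induction k generalizing n with
  | zero =>
    by_cases hV : (m, n) ∈ tileV C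
    · have h3 := (tileV_H hV).2.2
      have := hB _ (tileE_sub C h3)
      simp at this hk
      omega
    · apply SimpleGraph.Adj.reachable
      rw [tileG, SimpleGraph.fromRel_adj]
      refine ⟨?_, Or.inl (Or.inr ⟨⟨h, hV⟩, rfl⟩)⟩
      simp [Subtype.ext_iff]
  | succ k ih =>
    by_cases hV : (m, n) ∈ tileV C
    · obtain ⟨h1, h2, h3⟩ := tileV_H hV
      have e := ih h3 (by push_cast at hk; omega)
      exact ((tileG_reach_H h2).symm.trans e).trans (tileG_reach_H h1)
    · apply SimpleGraph.Adj.reachable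
      rw [tileG, SimpleGraph.fromRel_adj]
      refine ⟨?_, Or.inl (Or.inr ⟨⟨h, hV⟩, rfl⟩)⟩
      simp [Subtype.ext_iff]

theorem tileG_reach_col {C : Set (ℝ × ℝ)} {p : ℝ × ℝ} (hp : p ∈ C)
    {m n n' : ℤ} (h1 : p.1 ∈ Icc (m : ℝ) (m + 1)) (h2 : p.2 ∈ Icc (n : ℝ) (n + 1))
    (h2' : p.2 ∈ Icc (n' : ℝ) (n' + 1)) :
    (tileG C).Reachable ⟨(m, n), p, hp, h1, h2⟩ ⟨(m, n'), p, hp, h1, h2'⟩ := by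
  wlog hle : n ≤ n' generalizing n n'
  · exact (this h2' h2 (by omega)).symm
  have hle2 : n' ≤ n + 1 := by
    have : (n' : ℝ) ≤ n + 1 := h2'.1.trans h2.2
    exact_mod_cast this
  obtain rfl | hlt := hle.eq_or_lt
  · rfl
  · obtain rfl : n' = n + 1 := by omega
    have hE : (m, n + 1) ∈ tileH C := ⟨p, hp, h1, by
      have a := h2.2; have b := h2'.1; push_cast at b ⊢; linarith⟩
    have := tileG_reach_H hE
    convert this using 3
    simp

theorem tileG_reach_row {C : Set (ℝ × ℝ)} (hC : IsCompact C) {p : ℝ × ℝ} (hp : p ∈ C)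
    {m m' n : ℤ} (h1 : p.1 ∈ Icc (m : ℝ) (m + 1)) (h1' : p.1 ∈ Icc (m' : ℝ) (m' + 1))
    (h2 : p.2 ∈ Icc (n : ℝ) (n + 1)) :
    (tileG C).Reachable ⟨(m, n), p, hp, h1, h2⟩ ⟨(m', n), p, hp, h1', h2⟩ := by
  wlog hle : m ≤ m' generalizing m m'
  · exact (this h1' h1 (by omega)).symm
  have hle2 : m' ≤ m + 1 := by
    have : (m' : ℝ) ≤ m + 1 := h1'.1.trans h1.2
    exact_mod_cast this
  obtain rfl | hlt := hle.eq_or_lt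
  · rfl
  · obtain rfl : m' = m + 1 := by omega
    have hE : (m + 1, n) ∈ tileE C := ⟨p, hp, by
      have a := h1.2; have b := h1'.1; push_cast at b ⊢; linarith, h2⟩
    have := tileG_reach_E hC hE
    convert this using 3
    simp

theorem tileG_connected {C : Set (ℝ × ℝ)} (hC : IsCompact C) (hconn : IsConnected C) :
    (tileG C).Connected := by
  have hcover : ∀ p ∈ C, p.1 ∈ Icc ((⌊p.1⌋ : ℤ) : ℝ) (⌊p.1⌋ + 1) ∧
      p.2 ∈ Icc ((⌊p.2⌋ : ℤ) : ℝ) (⌊p.2⌋ + 1) := fun p _ =>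
    ⟨⟨Int.floor_le _, (Int.lt_floor_add_one _).le⟩, ⟨Int.floor_le _, (Int.lt_floor_add_one _).le⟩⟩
  have hne : Nonempty (tileF C) := by
    obtain ⟨p, hp⟩ := hconn.nonempty
    exact ⟨⟨(⌊p.1⌋, ⌊p.2⌋), p, hp, hcover p hp⟩⟩
  refine ⟨?_⟩
  intro a b
  by_contra hab
  let T : Set (ℤ × ℤ) := {g | ∃ h : g ∈ tileF C, (tileG C).Reachable a ⟨g, h⟩}
  let tile : ℤ × ℤ → Set (ℝ × ℝ) := fun g => Icc (g.1 : ℝ) (g.1 + 1) ×ˢ Icc (g.2 : ℝ) (g.2 + 1)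
  have hcl : ∀ S : Set (ℤ × ℤ), S ⊆ tileF C → IsClosed (⋃ g ∈ S, tile g) := fun S hS =>
    ((tileF_finite hC).subset hS).isClosed_biUnion (fun g _ => isClosed_Icc.prod isClosed_Icc)
  have hTF : T ⊆ tileF C := fun g hg => hg.1
  have key := isPreconnected_closed_iff.1 hconn.isPreconnected _ _ (hcl T hTF)
    (hcl (tileF C \ T) sdiff_subset) ?_ ?_ ?_
  · obtain ⟨p, hp, hp1, hp2⟩ := key
    simp only [mem_iUnion] at hp1 hp2
    obtain ⟨⟨m, n⟩, ⟨hgF, hg⟩, hpg⟩ := hp1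
    obtain ⟨⟨m', n'⟩, ⟨hgF', hg'⟩, hpg'⟩ := hp2
    apply hg'
    exact ⟨hgF', (hg.trans (tileG_reach_row hC hp hpg.1 hpg'.1 hpg.2)).trans
      (tileG_reach_col hp hpg'.1 hpg.2 hpg'.2)⟩
  · intro p hp
    have hF : (⌊p.1⌋, ⌊p.2⌋) ∈ tileF C := ⟨p, hp, hcover p hp⟩
    by_cases hT : (⌊p.1⌋, ⌊p.2⌋) ∈ T
    · left
      simp only [mem_iUnion]
      exact ⟨_, hT, hcover p hp⟩
    · right
      simp only [mem_iUnion]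
      exact ⟨_, ⟨hF, hT⟩, hcover p hp⟩
  · obtain ⟨p, hp, h⟩ := a.2
    refine ⟨p, hp, ?_⟩
    simp only [mem_iUnion]
    exact ⟨a, ⟨a.2, SimpleGraph.Reachable.refl _⟩, h⟩
  · obtain ⟨p, hp, h⟩ := b.2
    refine ⟨p, hp, ?_⟩
    simp only [mem_iUnion]
    exact ⟨b, ⟨b.2, fun ⟨_, h'⟩ => hab h'⟩, h⟩

theorem tile_euler {C : Set (ℝ × ℝ)} (hC : IsCompact C) (hconn : IsConnected C) :
    (tileF C).ncard + (tileV C).ncard ≤ (tileH C).ncard + (tileE C).ncard + 1 := by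
  have hfin := tileF_finite hC
  have hfinH := hfin.subset (tileH_sub C)
  have hfinE := hfin.subset (tileE_sub C)
  have hV : (tileE C \ tileV C).ncard + (tileV C).ncard = (tileE C).ncard :=
    ncard_sdiff_add_ncard_of_subset (tileV_sub C) hfinE
  have h1 := (tileG_connected hC hconn).card_vert_le_card_edgeSet_add_one
  have h2 : Nat.card (tileF C) = (tileF C).ncard := rfl
  have h3 : Nat.card (tileG C).edgeSet ≤ (tileH C).ncard + (tileE C \ tileV C).ncard := by
    have : Finite (tileH C) := hfinH
    have : Finite ↑(tileE C \ tileV C) := hfinE.subset sdiff_subset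
    have : (tileH C).ncard + (tileE C \ tileV C).ncard
        = Nat.card (tileH C ⊕ ↑(tileE C \ tileV C)) := by
      rw [Nat.card_sum]; rfl
    rw [this]
    let f : (tileH C ⊕ ↑(tileE C \ tileV C)) → Sym2 (tileF C) := fun x => match x with
      | Sum.inl g => s(⟨(g.1.1, g.1.2 - 1), tileH_sub' g.2⟩, ⟨g.1, tileH_sub C g.2⟩)
      | Sum.inr g => s(⟨(g.1.1 - 1, g.1.2), tileE_sub' g.2.1⟩, ⟨g.1, tileE_sub C g.2.1⟩)
    have hsub : (tileG C).edgeSet ⊆ range f := by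
      intro e
      induction e using Sym2.ind with
      | _ a b =>
        intro h
        rw [SimpleGraph.mem_edgeSet, tileG, SimpleGraph.fromRel_adj] at h
        obtain ⟨-, (⟨h, e⟩ | ⟨h, e⟩) | (⟨h, e⟩ | ⟨h, e⟩)⟩ := h
        · refine ⟨Sum.inl ⟨b, h⟩, ?_⟩
          simp only [f, ← e]
        · refine ⟨Sum.inr ⟨b, h⟩, ?_⟩
          simp only [f, ← e]
        · refine ⟨Sum.inl ⟨a, h⟩, ?_⟩
          simp only [f, ← e]
          exact Sym2.eq_swap
        · refine ⟨Sum.inr ⟨a, h⟩, ?_⟩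
          simp only [f, ← e]
          exact Sym2.eq_swap
    calc Nat.card (tileG C).edgeSet ≤ Nat.card (range f) :=
          Nat.card_mono (Set.finite_range f) hsub
      _ ≤ _ := by
        exact Nat.card_le_card_of_surjective _ (rangeFactorization_surjective (f := f))
  omega

/-! ### Part 2: the basic submodularity inequality -/

open scoped Pointwise

/-- the segment `[0, w]` -/
def seg (w : Plane) : Set Plane := (fun t : ℝ => t • w) '' Icc 0 1

theorem seg_compact (w : Plane) : IsCompact (seg w) :=
  isCompact_Icc.image (by fun_prop)

theorem seg_connected (w : Plane) : IsConnected (seg w) :=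
  (isConnected_Icc zero_le_one).image _ (by fun_prop)

theorem isConnected_add {A B : Set Plane} (hA : IsConnected A) (hB : IsConnected B) :
    IsConnected (A + B) := by
  rw [← Set.image2_add, ← Set.image_uncurry_prod]
  exact (hA.prod hB).image _ (by fun_prop)

/-- folding over the lattice spanned by a basis -/
theorem fold_measure (b : Module.Basis (Fin 2) ℝ Plane) {X : Set Plane} (hX : MeasurableSet X)
    (T : Plane → Set (ℤ × ℤ)) (hfin : ∀ x, (T x).Finite)
    (hT : ∀ x m n, (m, n) ∈ T x ↔ x - ((m : ℝ) • b 0 + (n : ℝ) • b 1) ∈ X) :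
    volume X = ∫⁻ x in ZSpan.fundamentalDomain b, ((T x).ncard : ℝ≥0∞) := by
  let e : (ℤ × ℤ) ≃ (Submodule.span ℤ (Set.range b)).toAddSubgroup :=
    (finTwoArrowEquiv ℤ).symm.trans (b.restrictScalars ℤ).equivFun.symm.toEquiv
  have : Countable (Submodule.span ℤ (Set.range b)).toAddSubgroup := e.symm.injective.countable
  have hF := ZSpan.isAddFundamentalDomain' b (volume : Measure Plane)
  have h1 := hF.lintegral_eq_tsum' (X.indicator 1)
  rw [lintegral_indicator_one hX] at h1
  rw [h1, ← lintegral_tsum]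
  · apply lintegral_congr
    intro x
    rw [← e.tsum_eq]
    have he : ∀ p : ℤ × ℤ, ((e p : _) : Plane) = (p.1 : ℝ) • b 0 + (p.2 : ℝ) • b 1 := by
      intro p
      change (((b.restrictScalars ℤ).equivFun.symm ((finTwoArrowEquiv ℤ).symm p) :
        Submodule.span ℤ (Set.range b)) : Plane) = _
      rw [Module.Basis.equivFun_symm_apply]
      simp [Fin.sum_univ_two, Int.cast_smul_eq_zsmul]
    have h2 : ∀ p : ℤ × ℤ, X.indicator (1 : Plane → ℝ≥0∞) (-(e p) +ᵥ x)
        = (T x).indicator (1 : ℤ × ℤ → ℝ≥0∞) p := by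
      intro p
      have : -(e p) +ᵥ x = x - ((p.1 : ℝ) • b 0 + (p.2 : ℝ) • b 1) := by
        rw [← he p, sub_eq_neg_add]; rfl
      rw [this]
      by_cases h : p ∈ T x
      · rw [indicator_of_mem h, indicator_of_mem ((hT x p.1 p.2).1 h)]; rfl
      · rw [indicator_of_notMem h, indicator_of_notMem (fun h' => h ((hT x p.1 p.2).2 h'))]
    rw [tsum_congr h2]
    rw [← tsum_subtype (T x) (1 : ℤ × ℤ → ℝ≥0∞)]
    have := ENNReal.tsum_set_one (T x)
    simp only [Pi.one_apply]
    rw [this, ← (hfin x).cast_ncard_eq]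
    rfl
  · intro g
    apply Measurable.aemeasurable
    apply (measurable_one.indicator hX).comp
    exact measurable_const_vadd _

theorem fold_measurable (b : Module.Basis (Fin 2) ℝ Plane) {X : Set Plane} (hX : MeasurableSet X)
    (T : Plane → Set (ℤ × ℤ)) (hfin : ∀ x, (T x).Finite)
    (hT : ∀ x m n, (m, n) ∈ T x ↔ x - ((m : ℝ) • b 0 + (n : ℝ) • b 1) ∈ X) :
    Measurable fun x => ((T x).ncard : ℝ≥0∞) := by
  have : (fun x => ((T x).ncard : ℝ≥0∞)) = fun x => ∑' p : ℤ × ℤ,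
      X.indicator (1 : Plane → ℝ≥0∞) (x - ((p.1 : ℝ) • b 0 + (p.2 : ℝ) • b 1)) := by
    funext x
    have h2 : ∀ p : ℤ × ℤ, X.indicator (1 : Plane → ℝ≥0∞)
        (x - ((p.1 : ℝ) • b 0 + (p.2 : ℝ) • b 1))
        = (T x).indicator (1 : ℤ × ℤ → ℝ≥0∞) p := by
      intro p
      by_cases h : p ∈ T x
      · rw [indicator_of_mem h, indicator_of_mem ((hT x p.1 p.2).1 h)]; rfl
      · rw [indicator_of_notMem h, indicator_of_notMem (fun h' => h ((hT x p.1 p.2).2 h'))]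
    rw [tsum_congr h2, ← tsum_subtype (T x) (1 : ℤ × ℤ → ℝ≥0∞)]
    have := ENNReal.tsum_set_one (T x)
    simp only [Pi.one_apply]
    rw [this, ← (hfin x).cast_ncard_eq]
    rfl
  rw [this]
  apply Measurable.tsum
  intro p
  exact (measurable_one.indicator hX).comp (measurable_id.sub_const _)

theorem key_basis (b : Module.Basis (Fin 2) ℝ Plane) {A : Set Plane} (hA : IsCompact A)
    (hc : IsConnected A) :
    volume (A + seg (b 0) + seg (b 1)) + volume A ≤ volume (A + seg (b 0)) + volume (A + seg (b 1))
      + volume (ZSpan.fundamentalDomain b) := by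
  let L : Plane → ℝ × ℝ := fun x => (b.repr x 0, b.repr x 1)
  have hL : Continuous L := by
    have : ∀ i, Continuous fun x => b.repr x i := fun i =>
      ((b.coord i).continuous_of_finiteDimensional)
    exact (this 0).prodMk (this 1)
  have hLx : ∀ x, x = (L x).1 • b 0 + (L x).2 • b 1 := by
    intro x
    have := (b.sum_repr x).symm
    rwa [Fin.sum_univ_two] at this
  have hLc : ∀ s t : ℝ, L (s • b 0 + t • b 1) = (s, t) := by
    intro s t
    simp [L]
  let C : Plane → Set (ℝ × ℝ) := fun x => (fun a => L (x - a)) '' A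
  have hCc : ∀ x, IsCompact (C x) := fun x => hA.image (by fun_prop)
  have hCn : ∀ x, IsConnected (C x) := fun x => hc.image _ (by fun_prop)
  have hfF := fun x => tileF_finite (hCc x)
  have hfH := fun x => (hfF x).subset (tileH_sub (C x))
  have hfE := fun x => (hfF x).subset (tileE_sub (C x))
  have hfV := fun x => (hfE x).subset (tileV_sub (C x))
  have mA := hA.measurableSet
  have mH := (hA.add (seg_compact (b 0))).measurableSet
  have mE := (hA.add (seg_compact (b 1))).measurableSet
  have mF := ((hA.add (seg_compact (b 0))).add (seg_compact (b 1))).measurableSet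
  have TF : ∀ x m n, (m, n) ∈ tileF (C x) ↔
      x - ((m : ℝ) • b 0 + (n : ℝ) • b 1) ∈ A + seg (b 0) + seg (b 1) := by
    intro x m n
    constructor
    · rintro ⟨_, ⟨a, ha, rfl⟩, h1, h2⟩
      refine ⟨a + ((L (x - a)).1 - m) • b 0, ⟨a, ha, _, ⟨(L (x - a)).1 - m, ?_, rfl⟩, rfl⟩, _,
        ⟨(L (x - a)).2 - n, ?_, rfl⟩, ?_⟩
      · simp only [mem_Icc] at h1 ⊢; constructor <;> linarith
      · simp only [mem_Icc] at h2 ⊢; constructor <;> linarith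
      · have := hLx (x - a)
        generalize (L (x - a)).1 = α at *
        generalize (L (x - a)).2 = β at *
        simp only
        rw [eq_add_of_sub_eq' this]
        module
    · rintro ⟨_, ⟨a, ha, _, ⟨s, hs, rfl⟩, rfl⟩, _, ⟨t, ht, rfl⟩, h⟩
      refine ⟨_, ⟨a, ha, rfl⟩, ?_⟩
      have : x - a = (m + s) • b 0 + (n + t) • b 1 := by
        simp only at h
        rw [← sub_eq_zero] at h ⊢
        rw [← neg_eq_zero, ← h]
        module
      simp only [this, hLc, mem_Icc] at hs ht ⊢
      refine ⟨⟨?_, ?_⟩, ?_, ?_⟩ <;> linarith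
  have TH : ∀ x m n, (m, n) ∈ tileH (C x) ↔
      x - ((m : ℝ) • b 0 + (n : ℝ) • b 1) ∈ A + seg (b 0) := by
    intro x m n
    constructor
    · rintro ⟨_, ⟨a, ha, rfl⟩, h1, h2⟩
      refine ⟨a, ha, _, ⟨(L (x - a)).1 - m, ?_, rfl⟩, ?_⟩
      · simp only [mem_Icc] at h1 ⊢; constructor <;> linarith
      · have := hLx (x - a)
        simp only at h2
        rw [h2] at this
        generalize (L (x - a)).1 = α at *
        generalize (L (x - a)).2 = β at *
        simp only
        rw [eq_add_of_sub_eq' this]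
        module
    · rintro ⟨a, ha, _, ⟨s, hs, rfl⟩, h⟩
      refine ⟨_, ⟨a, ha, rfl⟩, ?_⟩
      have : x - a = (m + s) • b 0 + (n : ℝ) • b 1 := by
        simp only at h
        rw [← sub_eq_zero] at h ⊢
        rw [← neg_eq_zero, ← h]
        module
      simp only [this, hLc, mem_Icc] at hs ⊢
      refine ⟨⟨?_, ?_⟩, trivial⟩ <;> linarith
  have TE : ∀ x m n, (m, n) ∈ tileE (C x) ↔
      x - ((m : ℝ) • b 0 + (n : ℝ) • b 1) ∈ A + seg (b 1) := by
    intro x m n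
    constructor
    · rintro ⟨_, ⟨a, ha, rfl⟩, h1, h2⟩
      refine ⟨a, ha, _, ⟨(L (x - a)).2 - n, ?_, rfl⟩, ?_⟩
      · simp only [mem_Icc] at h2 ⊢; constructor <;> linarith
      · have := hLx (x - a)
        simp only at h1
        rw [h1] at this
        generalize (L (x - a)).1 = α at *
        generalize (L (x - a)).2 = β at *
        simp only
        rw [eq_add_of_sub_eq' this]
        module
    · rintro ⟨a, ha, _, ⟨s, hs, rfl⟩, h⟩
      refine ⟨_, ⟨a, ha, rfl⟩, ?_⟩
      have : x - a = (m : ℝ) • b 0 + (n + s) • b 1 := by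
        simp only at h
        rw [← sub_eq_zero] at h ⊢
        rw [← neg_eq_zero, ← h]
        module
      simp only [this, hLc, mem_Icc] at hs ⊢
      refine ⟨trivial, ⟨?_, ?_⟩⟩ <;> linarith
  have TV : ∀ x m n, (m, n) ∈ tileV (C x) ↔
      x - ((m : ℝ) • b 0 + (n : ℝ) • b 1) ∈ A := by
    intro x m n
    constructor
    · rintro ⟨_, ⟨a, ha, rfl⟩, h1, h2⟩
      have := hLx (x - a)
      simp only at h1 h2
      rw [h1, h2] at this
      rw [← this]
      simpa using ha
    · intro h
      refine ⟨_, ⟨_, h, rfl⟩, ?_⟩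
      simp only [_root_.sub_sub_cancel, hLc]
      exact ⟨trivial, trivial⟩
  rw [fold_measure b mF _ hfF TF, fold_measure b mA _ hfV TV, fold_measure b mH _ hfH TH,
    fold_measure b mE _ hfE TE, ← setLIntegral_one, ← lintegral_add_right _
    (fold_measurable b mA _ hfV TV), ← lintegral_add_right _
    (fold_measurable b mE _ hfE TE), ← lintegral_add_right _ measurable_const]
  apply lintegral_mono
  intro x
  have := tile_euler (hCc x) (hCn x)
  simp only
  exact_mod_cast this

/-- planar determinant, absolute value -/
noncomputable def crs (u v : Plane) : ℝ := |u 0 * v 1 - u 1 * v 0|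

theorem crs_nonneg (u v : Plane) : 0 ≤ crs u v := abs_nonneg _

theorem key_indep {u v : Plane} (huv : u 0 * v 1 - u 1 * v 0 ≠ 0) {A : Set Plane}
    (hA : IsCompact A) (hc : IsConnected A) :
    volume (A + seg u + seg v) + volume A ≤ volume (A + seg u) + volume (A + seg v)
      + ENNReal.ofReal (crs u v) := by
  have hli : LinearIndependent ℝ ![u, v] := by
    rw [LinearIndependent.pair_iff]
    intro s t h
    have h0 := congrArg (fun x : Plane => x 0) h
    have h1 := congrArg (fun x : Plane => x 1) h
    simp at h0 h1
    constructor
    · have : s * (u 0 * v 1 - u 1 * v 0) = 0 := by linear_combination v 1 * h0 - v 0 * h1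
      exact (mul_eq_zero.1 this).resolve_right huv
    · have : t * (u 0 * v 1 - u 1 * v 0) = 0 := by linear_combination - u 1 * h0 + u 0 * h1
      exact (mul_eq_zero.1 this).resolve_right huv
  let b := basisOfLinearIndependentOfCardEqFinrank hli (by simp)
  have hb : ⇑b = ![u, v] := coe_basisOfLinearIndependentOfCardEqFinrank hli (by simp)
  have h := key_basis b hA hc
  let b0 := EuclideanSpace.basisFun (Fin 2) ℝ
  rw [ZSpan.measure_fundamentalDomain b volume b0.toBasis,
    measure_congr (ZSpan.fundamentalDomain_ae_parallelepiped b0.toBasis volume)] at h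
  have h1 : volume (parallelepiped b0.toBasis) = 1 := by
    rw [OrthonormalBasis.coe_toBasis]; exact b0.volume_parallelepiped
  rw [h1, mul_one, Module.Basis.det_apply, Matrix.det_fin_two] at h
  simp only [hb, Module.Basis.toMatrix_apply, b0] at h
  simp at h
  have e : crs u v = |u 0 * v 1 - v 0 * u 1| := by rw [crs, mul_comm (v 0)]
  rw [e]
  exact h

theorem seg_zero : seg 0 = {0} := by
  ext x
  simp only [seg, smul_zero, mem_image, mem_Icc, mem_singleton_iff]
  exact ⟨fun ⟨_, _, h⟩ => h.symm, fun h => ⟨0, by simp, h.symm⟩⟩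

theorem key_par {u : Plane} {c : ℝ} (hc0 : 0 ≤ c) {A : Set Plane}
    (hA : IsCompact A) :
    volume (A + seg u + seg (c • u)) + volume A ≤ volume (A + seg u) + volume (A + seg (c • u)) := by
  have hsub : A ⊆ A + seg (c • u) := fun a ha => ⟨a, ha, 0, ⟨0, by simp, by simp⟩, by simp⟩
  have hsub2 : A + seg u ⊆ A + seg u + seg (c • u) :=
    fun a ha => ⟨a, ha, 0, ⟨0, by simp, by simp⟩, by simp⟩
  have m1 := (hA.add (seg_compact u)).measurableSet
  have key : volume ((A + seg u + seg (c • u)) \ (A + seg u)) ≤ volume ((A + seg (c • u)) \ A) := by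
    rw [← measure_preimage_add volume u ((A + seg u + seg (c • u)) \ (A + seg u))]
    apply measure_mono
    rintro x ⟨⟨_, ⟨a, ha, _, ⟨s, hs, rfl⟩, rfl⟩, _, ⟨t, ht, rfl⟩, h⟩, hx⟩
    simp only at h
    have hx' : x = a + (s + t * c - 1) • u := by
      rw [← sub_eq_zero] at h ⊢
      rw [← neg_eq_zero, ← h]
      module
    simp only [mem_Icc] at hs ht
    have hpos : 1 < s + t * c := by
      by_contra hle
      apply hx
      refine ⟨a, ha, _, ⟨s + t * c, ⟨?_, ?_⟩, rfl⟩, ?_⟩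
      · have := mul_nonneg ht.1 hc0
        linarith
      · linarith
      · rw [hx']
        module
    refine ⟨⟨a, ha, _, ⟨(s + t * c - 1) / c, ?_, rfl⟩, ?_⟩, ?_⟩
    · have hcpos : 0 < c := by
        rcases hc0.eq_or_lt with h | h
        · rw [← h] at hpos; linarith
        · exact h
      constructor
      · apply div_nonneg <;> linarith
      · rw [div_le_one hcpos]
        nlinarith
    · have hcpos : c ≠ 0 := by
        rintro rfl
        linarith
      rw [hx']
      simp only
      rw [smul_smul, div_mul_cancel₀ _ hcpos]
    · intro hxA
      apply hx
      exact ⟨x, hxA, u, ⟨1, by simp, by simp⟩, add_comm _ _⟩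
  have e1 := measure_sdiff_add_inter (μ := volume) (A + seg u + seg (c • u)) m1
  have e2 := measure_sdiff_add_inter (μ := volume) (A + seg (c • u)) hA.measurableSet
  rw [inter_eq_right.2 hsub2] at e1
  rw [inter_eq_right.2 hsub] at e2
  rw [← e1, ← e2]
  calc _ ≤ volume ((A + seg (c • u)) \ A) + volume (A + seg u) + volume A := by gcongr
    _ = _ := by ring

theorem volume_add_seg_neg (A : Set Plane) (v : Plane) :
    volume (A + seg (-v)) = volume (A + seg v) := by
  rw [← measure_preimage_add volume v (A + seg v)]
  congr 1
  ext x
  constructor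
  · rintro ⟨a, ha, _, ⟨t, ht, rfl⟩, rfl⟩
    refine ⟨a, ha, _, ⟨1 - t, ⟨by linarith [ht.2], by linarith [ht.1]⟩, rfl⟩, ?_⟩
    simp only
    module
  · rintro ⟨a, ha, _, ⟨t, ht, rfl⟩, h⟩
    refine ⟨a, ha, _, ⟨1 - t, ⟨by linarith [ht.2], by linarith [ht.1]⟩, rfl⟩, ?_⟩
    simp only at h ⊢
    have : x = a + t • v - v := by rw [h]; abel
    rw [this]
    module

theorem key_general (u v : Plane) {A : Set Plane} (hA : IsCompact A) (hc : IsConnected A) :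
    volume (A + seg u + seg v) + volume A ≤ volume (A + seg u) + volume (A + seg v)
      + ENNReal.ofReal (crs u v) := by
  by_cases huv : u 0 * v 1 - u 1 * v 0 = 0
  · apply le_add_right
    by_cases hu : u = 0
    · rw [hu, seg_zero]
      simp [add_comm]
    have : ∃ c : ℝ, v = c • u := by
      by_cases h0 : u 0 = 0
      · have h1 : u 1 ≠ 0 := by
          intro h1; apply hu; ext i; fin_cases i <;> simp [h0, h1]
        refine ⟨v 1 / u 1, ?_⟩
        ext i; fin_cases i
        · simp [h0]
          simpa [h0, h1] using huv
        · simp [h1]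
      · refine ⟨v 0 / u 0, ?_⟩
        ext i; fin_cases i
        · simp [h0]
        · simp
          field_simp
          linarith
    obtain ⟨c, rfl⟩ := this
    rcases le_total 0 c with h | h
    · exact key_par h hA
    · have := key_par (u := u) (c := -c) (by linarith) hA
      rwa [neg_smul, volume_add_seg_neg, volume_add_seg_neg] at this
  · exact key_indep huv hA hc

/-! ### Part 3: zonotopes -/

/-- zonotope spanned by a list of segments -/
def zon : List Plane → Set Plane
  | [] => {0}
  | w :: l => zon l + seg w

theorem zon_compact (l : List Plane) : IsCompact (zon l) := by
  induction l with
  | nil => exact isCompact_singleton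
  | cons w l ih => exact ih.add (seg_compact w)

theorem zon_connected (l : List Plane) : IsConnected (zon l) := by
  induction l with
  | nil => exact isConnected_singleton
  | cons w l ih => exact isConnected_add ih (seg_connected w)

theorem seg_convex (w : Plane) : Convex ℝ (seg w) :=
  (convex_Icc (0 : ℝ) 1).is_linear_image (IsLinearMap.isLinearMap_smul' w)

theorem zon_convex (l : List Plane) : Convex ℝ (zon l) := by
  induction l with
  | nil => exact convex_singleton 0
  | cons w l ih => exact ih.add (seg_convex w)

theorem seg_smul (t : ℝ) (w : Plane) : seg (t • w) = t • seg w := by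
  ext x
  constructor
  · rintro ⟨s, hs, rfl⟩
    exact ⟨s • w, ⟨s, hs, rfl⟩, smul_comm _ _ _⟩
  · rintro ⟨_, ⟨s, hs, rfl⟩, rfl⟩
    exact ⟨s, hs, smul_comm _ _ _⟩

theorem zon_smul (t : ℝ) (l : List Plane) : zon (l.map (t • ·)) = t • zon l := by
  induction l with
  | nil => simp [zon]
  | cons w l ih => simp only [List.map_cons, zon, ih, seg_smul, smul_add]

/-- area as a real number -/
noncomputable def ar (A : Set Plane) : ℝ := (volume A).toReal

theorem key_real (u v : Plane) {A : Set Plane} (hA : IsCompact A) (hc : IsConnected A) :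
    ar (A + seg u + seg v) + ar A ≤ ar (A + seg u) + ar (A + seg v) + crs u v := by
  have h := key_general u v hA hc
  have f0 := hA.measure_ne_top (μ := volume)
  have f1 := (hA.add (seg_compact u)).measure_ne_top (μ := volume)
  have f2 := (hA.add (seg_compact v)).measure_ne_top (μ := volume)
  have f3 := ((hA.add (seg_compact u)).add (seg_compact v)).measure_ne_top (μ := volume)
  have h2 := ENNReal.toReal_mono (by finiteness) h
  rw [ENNReal.toReal_add f3 f0, ENNReal.toReal_add (by finiteness) (by finiteness),
    ENNReal.toReal_add f1 f2, ENNReal.toReal_ofReal (crs_nonneg u v)] at h2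
  exact h2

theorem zon_ineq1 (u : Plane) (W : List Plane) {A : Set Plane} (hA : IsCompact A)
    (hc : IsConnected A) :
    ar (A + seg u + zon W) + ar A ≤ ar (A + seg u) + ar (A + zon W)
      + (W.map (fun w => crs u w)).sum := by
  induction W with
  | nil => simp [zon]
  | cons w W ih =>
    have h := key_real u w (hA.add (zon_compact W)) (isConnected_add hc (zon_connected W))
    simp only [zon, List.map_cons, List.sum_cons]
    have e1 : A + seg u + (zon W + seg w) = A + zon W + seg u + seg w := by
      rw [← add_assoc, add_right_comm A]
    have e2 : A + (zon W + seg w) = A + zon W + seg w := (add_assoc _ _ _).symm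
    have e3 : A + seg u + zon W = A + zon W + seg u := add_right_comm _ _ _
    rw [e3] at ih
    rw [e1, e2]
    linarith

theorem zon_ineq2 (U W : List Plane) {A : Set Plane} (hA : IsCompact A)
    (hc : IsConnected A) :
    ar (A + zon U + zon W) + ar A ≤ ar (A + zon U) + ar (A + zon W)
      + (U.map (fun u => (W.map (fun w => crs u w)).sum)).sum := by
  induction U with
  | nil => simp [zon, add_comm]
  | cons u U ih =>
    have h := zon_ineq1 u W (hA.add (zon_compact U)) (isConnected_add hc (zon_connected U))
    simp only [zon, List.map_cons, List.sum_cons]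
    rw [← add_assoc A]
    linarith

/-- twice the mixed area constant -/
noncomputable def dz (l : List Plane) : ℝ :=
  (l.map (fun u => (l.map (fun w => crs u w)).sum)).sum

theorem crs_smul {s t : ℝ} (hs : 0 ≤ s) (ht : 0 ≤ t) (u v : Plane) :
    crs (s • u) (t • v) = s * t * crs u v := by
  simp only [crs, PiLp.smul_apply, smul_eq_mul]
  rw [← abs_of_nonneg (mul_nonneg hs ht), ← abs_mul]
  congr 1
  ring

theorem zon_ineq3 (l : List Plane) {s t : ℝ} (hs : 0 ≤ s) (ht : 0 ≤ t) {A : Set Plane}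
    (hA : IsCompact A) (hc : IsConnected A) :
    ar (A + (s + t) • zon l) + ar A ≤ ar (A + s • zon l) + ar (A + t • zon l) + s * t * dz l := by
  have h := zon_ineq2 (l.map (s • ·)) (l.map (t • ·)) hA hc
  rw [zon_smul, zon_smul, add_assoc A, ← (zon_convex l).add_smul hs ht] at h
  simp only [List.map_map, Function.comp_def, crs_smul hs ht, List.sum_map_mul_left] at h
  exact h

theorem dz_nonneg (l : List Plane) : 0 ≤ dz l := by
  apply List.sum_nonneg
  intro x hx
  obtain ⟨u, -, rfl⟩ := List.mem_map.1 hx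
  apply List.sum_nonneg
  intro x hx
  obtain ⟨v, -, rfl⟩ := List.mem_map.1 hx
  exact crs_nonneg _ _

theorem zon_ineq4 (l : List Plane) {s : ℝ} (hs : 0 ≤ s) {A : Set Plane}
    (hA : IsCompact A) (hc : IsConnected A) (n : ℕ) :
    ar (A + ((n : ℝ) * s) • zon l) - ar A ≤ n * (ar (A + s • zon l) - ar A)
      + (n * s) ^ 2 * (dz l / 2) := by
  induction n with
  | zero =>
    have : (0 : ℝ) • zon l = {0} := zero_smul_set (zon_connected l).nonempty
    simp [this]
  | succ n ih =>
    have h := zon_ineq3 l hs (mul_nonneg n.cast_nonneg hs) hA hc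
    have e : s + (n : ℝ) * s = ((n + 1 : ℕ) : ℝ) * s := by push_cast; ring
    rw [e] at h
    have := mul_nonneg (mul_nonneg hs hs) (dz_nonneg l)
    push_cast at *
    nlinarith

/-- center of the zonotope -/
noncomputable def cz (l : List Plane) : Plane := (1 / 2 : ℝ) • l.sum

/-- support function of the centered zonotope -/
noncomputable def hz (l : List Plane) (w : Plane) : ℝ := (l.map (fun u => |inner ℝ w u|)).sum / 2

theorem zon_supp_le (l : List Plane) (w : Plane) : ∀ x ∈ zon l, inner ℝ w (x - cz l) ≤ hz l w := by
  induction l with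
  | nil =>
    intro x hx
    have : x = 0 := hx
    simp [this, cz, hz]
  | cons u l ih =>
    rintro _ ⟨x, hx, _, ⟨t, ht, rfl⟩, rfl⟩
    have h1 := ih x hx
    have h2 : x + t • u - cz (u :: l) = (x - cz l) + (t - 1 / 2) • u := by
      simp only [cz, List.sum_cons]; module
    simp only [h2, inner_add_right, inner_smul_right, hz, List.map_cons, List.sum_cons] at h1 ⊢
    have h3 : (t - 1 / 2) * inner ℝ w u ≤ 1 / 2 * |inner ℝ w u| := by
      apply (le_abs_self _).trans
      rw [abs_mul]
      apply mul_le_mul_of_nonneg_right _ (abs_nonneg _)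
      rw [abs_le]
      constructor <;> linarith [ht.1, ht.2]
    linarith

theorem zon_supp_att (l : List Plane) (w : Plane) : ∃ x ∈ zon l, inner ℝ w (x - cz l) = hz l w := by
  induction l with
  | nil => exact ⟨0, rfl, by simp [cz, hz]⟩
  | cons u l ih =>
    obtain ⟨x, hx, h1⟩ := ih
    have h2 : ∀ t : ℝ, x + t • u - cz (u :: l) = (x - cz l) + (t - 1 / 2) • u := by
      intro t
      simp only [cz, List.sum_cons]; module
    rcases le_total 0 (inner ℝ w u) with h | h
    · refine ⟨x + (1 : ℝ) • u, ⟨x, hx, _, ⟨1, by simp, rfl⟩, rfl⟩, ?_⟩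
      simp only [h2, inner_add_right, inner_smul_right, hz, List.map_cons, List.sum_cons,
        abs_of_nonneg h] at h1 ⊢
      linarith
    · refine ⟨x + (0 : ℝ) • u, ⟨x, hx, _, ⟨0, by simp, rfl⟩, rfl⟩, ?_⟩
      simp only [h2, inner_add_right, inner_smul_right, hz, List.map_cons, List.sum_cons,
        abs_of_nonpos h] at h1 ⊢
      linarith

theorem zon_sub_ball (l : List Plane) {R : ℝ} (hR : ∀ w, hz l w ≤ R * ‖w‖) :
    zon l ⊆ closedBall (cz l) R := by
  intro x hx
  rw [mem_closedBall, dist_eq_norm]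
  have h := (zon_supp_le l (x - cz l) x hx).trans (hR _)
  rw [real_inner_self_eq_norm_sq] at h
  rcases (norm_nonneg (x - cz l)).eq_or_lt with h0 | h0
  · obtain ⟨w, hw⟩ := exists_ne (0 : Plane)
    have h1 : 0 ≤ hz l w := by
      apply div_nonneg _ zero_le_two
      apply List.sum_nonneg
      intro y hy
      obtain ⟨v, -, rfl⟩ := List.mem_map.1 hy
      exact abs_nonneg _
    rw [← h0]
    have := h1.trans (hR w)
    exact nonneg_of_mul_nonneg_left this (norm_pos_iff.2 hw)
  · nlinarith

theorem ball_sub_zon (l : List Plane) {r : ℝ} (hr : ∀ w, r * ‖w‖ ≤ hz l w) :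
    closedBall (cz l) r ⊆ zon l := by
  intro x hx
  rw [mem_closedBall, dist_eq_norm] at hx
  by_contra hxZ
  obtain ⟨f, s, h1, h2⟩ := geometric_hahn_banach_closed_point (zon_convex l)
    (zon_compact l).isClosed hxZ
  obtain ⟨w, rfl⟩ := (InnerProductSpace.toDual ℝ Plane).surjective f
  simp only [InnerProductSpace.toDual_apply_apply] at h1 h2
  obtain ⟨a, ha, h3⟩ := zon_supp_att l w
  have h4 := h1 a ha
  have h5 := hr w
  have h6 := real_inner_le_norm w (x - cz l)
  rw [inner_sub_right] at h3 h6
  have h7 := mul_le_mul_of_nonneg_left hx (norm_nonneg w)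
  linarith

theorem dz_le (l : List Plane) {R : ℝ} (hR : ∀ w, hz l w ≤ R * ‖w‖) :
    dz l / 2 ≤ R * (l.map (fun u => ‖u‖)).sum := by
  have h : ∀ u : Plane, (l.map (fun w => crs u w)).sum ≤ 2 * R * ‖u‖ := by
    intro u
    have h1 := hR !₂[-u 1, u 0]
    have h2 : ‖(!₂[-u 1, u 0] : Plane)‖ = ‖u‖ := by
      simp [EuclideanSpace.norm_eq, Fin.sum_univ_two, add_comm]
    have h3 : ∀ v : Plane, |inner ℝ (!₂[-u 1, u 0] : Plane) v| = crs u v := by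
      intro v
      simp only [crs, PiLp.inner_apply, Fin.sum_univ_two]
      simp
      congr 1
      ring
    rw [h2] at h1
    simp only [hz, h3] at h1
    linarith
  have : dz l ≤ (l.map (fun u => 2 * R * ‖u‖)).sum := List.sum_le_sum (fun u _ => h u)
  rw [List.sum_map_mul_left] at this
  linarith

/-! ### Part 4: approximating the disc by zonotopes -/

theorem integral_abs_cos (θ : ℝ) : ∫ x in (0 : ℝ)..Real.pi, |Real.cos (θ - x)| = 2 := by
  have hper : Function.Periodic (fun x => |Real.cos x|) Real.pi := by
    intro x
    simp [Real.cos_add_pi]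
  rw [intervalIntegral.integral_comp_sub_left (fun x => |Real.cos x|) θ]
  have h := hper.intervalIntegral_add_eq (θ - Real.pi) (-(Real.pi / 2))
  rw [sub_add_cancel] at h
  rw [sub_zero, h]
  have e : -(Real.pi / 2) + Real.pi = Real.pi / 2 := by ring
  rw [e]
  have : ∫ x in (-(Real.pi / 2))..(Real.pi / 2), |Real.cos x|
      = ∫ x in (-(Real.pi / 2))..(Real.pi / 2), Real.cos x := by
    apply intervalIntegral.integral_congr
    intro x hx
    rw [uIcc_of_le (by linarith [Real.pi_pos])] at hx
    exact abs_of_nonneg (Real.cos_nonneg_of_mem_Icc hx)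
  rw [this, integral_cos]
  simp
  norm_num

theorem riemann_cos (θ : ℝ) {N : ℕ} (hN : 0 < N) :
    |Real.pi / N * ∑ k ∈ Finset.range N, |Real.cos (θ - Real.pi * k / N)| - 2|
      ≤ Real.pi ^ 2 / N := by
  have hN' : (0 : ℝ) < N := by exact_mod_cast hN
  have hpi := Real.pi_pos
  let f : ℝ → ℝ := fun x => |Real.cos (θ - x)|
  have hf : Continuous f := by fun_prop
  let a : ℕ → ℝ := fun k => Real.pi * k / N
  have hstep : ∀ k, a (k + 1) - a k = Real.pi / N := by
    intro k; simp only [a]; push_cast; field_simp; ring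
  have hsum : ∑ k ∈ Finset.range N, ∫ x in a k..a (k + 1), f x = 2 := by
    rw [intervalIntegral.sum_integral_adjacent_intervals
      (fun k _ => hf.intervalIntegrable _ _)]
    have h0 : a 0 = 0 := by simp [a]
    have h1 : a N = Real.pi := by simp only [a]; field_simp
    rw [h0, h1]
    exact integral_abs_cos θ
  have hpiece : ∀ k, |Real.pi / N * f (a k) - ∫ x in a k..a (k + 1), f x| ≤ (Real.pi / N) ^ 2 := by
    intro k
    have e1 : Real.pi / N * f (a k) = ∫ x in a k..a (k + 1), f (a k) := by
      rw [intervalIntegral.integral_const, hstep, smul_eq_mul]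
    rw [e1, ← intervalIntegral.integral_sub (by simp) (hf.intervalIntegrable _ _)]
    have := intervalIntegral.norm_integral_le_of_norm_le_const (a := a k) (b := a (k + 1))
      (f := fun x => f (a k) - f x) (C := Real.pi / N) ?_
    · rw [Real.norm_eq_abs, hstep, abs_of_pos (div_pos hpi hN')] at this
      rw [sq]; exact this
    · intro x hx
      have hle : a k ≤ a (k + 1) := by
        have := hstep k
        have := div_pos hpi hN'
        linarith
      rw [uIoc_of_le hle] at hx
      rw [Real.norm_eq_abs]
      calc |f (a k) - f x| ≤ |Real.cos (θ - a k) - Real.cos (θ - x)| := abs_abs_sub_abs_le _ _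
        _ ≤ |(θ - a k) - (θ - x)| := Real.abs_cos_sub_cos_le _ _
        _ ≤ Real.pi / N := by
          rw [abs_le]
          have := hstep k
          have := div_pos hpi hN'
          constructor <;> linarith [hx.1, hx.2]
  rw [← hsum, Finset.mul_sum, ← Finset.sum_sub_distrib]
  calc _ ≤ ∑ k ∈ Finset.range N, |Real.pi / N * f (a k) - ∫ x in a k..a (k + 1), f x| :=
        Finset.abs_sum_le_sum_abs _ _
    _ ≤ ∑ k ∈ Finset.range N, (Real.pi / N) ^ 2 := Finset.sum_le_sum (fun k _ => hpiece k)
    _ = Real.pi ^ 2 / N := by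
      rw [Finset.sum_const, Finset.card_range, nsmul_eq_mul]; field_simp

theorem plane_polar (w : Plane) : ∃ θ : ℝ, w 0 = ‖w‖ * Real.cos θ ∧ w 1 = ‖w‖ * Real.sin θ := by
  let z : ℂ := ⟨w 0, w 1⟩
  have hz : ‖z‖ = ‖w‖ := by
    rw [Complex.norm_def, Complex.normSq_apply, EuclideanSpace.norm_eq, Fin.sum_univ_two]
    simp [z, sq]
  refine ⟨z.arg, ?_, ?_⟩
  · rw [← hz, Complex.norm_mul_cos_arg]
  · rw [← hz, Complex.norm_mul_sin_arg]

theorem exists_zon {τ : ℝ} (hτ : 0 < τ) : ∃ l : List Plane,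
    (∀ w, hz l w ≤ (1 + τ) * ‖w‖) ∧ (∀ w, (1 - τ) * ‖w‖ ≤ hz l w) ∧
    (l.map (fun u => ‖u‖)).sum = Real.pi := by
  obtain ⟨N, hN⟩ := exists_nat_gt (Real.pi ^ 2 / τ)
  have hpi := Real.pi_pos
  have hN' : (0 : ℝ) < N := lt_trans (by positivity) hN
  have hN0 : 0 < N := by exact_mod_cast hN'
  have hsmall : Real.pi ^ 2 / N ≤ τ := by
    rw [div_lt_iff₀ hτ] at hN
    rw [div_le_iff₀ hN']
    linarith
  let u : ℕ → Plane := fun k =>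
    (Real.pi / N) • !₂[Real.cos (Real.pi * k / N), Real.sin (Real.pi * k / N)]
  let l : List Plane := (List.range N).map u
  have hh : ∀ w, ∃ θ, hz l w = ‖w‖ / 2 *
      (Real.pi / N * ∑ k ∈ Finset.range N, |Real.cos (θ - Real.pi * k / N)|) := by
    intro w
    obtain ⟨θ, h0, h1⟩ := plane_polar w
    refine ⟨θ, ?_⟩
    have hk : ∀ k, |inner ℝ w (u k)| = ‖w‖ * (Real.pi / N) * |Real.cos (θ - Real.pi * k / N)| := by
      intro k
      have : inner ℝ w (u k) = ‖w‖ * (Real.pi / N) * Real.cos (θ - Real.pi * k / N) := by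
        simp only [u, inner_smul_right, PiLp.inner_apply, Fin.sum_univ_two, Real.cos_sub]
        simp [h0, h1]
        ring
      rw [this, abs_mul, abs_of_nonneg (by positivity)]
    simp only [hz, l, List.map_map, Function.comp_def, hk]
    rw [List.sum_map_mul_left]
    have : ((List.range N).map (fun k : ℕ => |Real.cos (θ - Real.pi * k / N)|)).sum =
      ∑ k ∈ Finset.range N, |Real.cos (θ - Real.pi * k / N)| := rfl
    rw [this]
    ring
  refine ⟨l, ?_, ?_, ?_⟩
  · intro w
    obtain ⟨θ, hθ⟩ := hh w
    have := (abs_le.1 (riemann_cos θ hN0)).2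
    rw [hθ]
    have h0 := norm_nonneg w
    nlinarith
  · intro w
    obtain ⟨θ, hθ⟩ := hh w
    have := (abs_le.1 (riemann_cos θ hN0)).1
    rw [hθ]
    have h0 := norm_nonneg w
    nlinarith
  · have hk : ∀ k, ‖u k‖ = Real.pi / N := by
      intro k
      simp only [u, norm_smul]
      rw [Real.norm_eq_abs, abs_of_nonneg (by positivity)]
      simp [EuclideanSpace.norm_eq, Fin.sum_univ_two]
    simp only [l, List.map_map, Function.comp_def, hk]
    simp
    field_simp

/-! ### Part 5: conclusion -/

theorem ar_mono {A B : Set Plane} (h : A ⊆ B) (hB : IsCompact B) : ar A ≤ ar B :=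
  ENNReal.toReal_mono (hB.measure_ne_top (μ := volume)) (measure_mono h)

theorem ar_translate (A : Set Plane) (c : Plane) : ar ((fun x => c + x) ⁻¹' A) = ar A := by
  rw [ar, measure_preimage_add, ar]

theorem cthickening_eq_add {K : Set Plane} (hK : IsCompact K) {t : ℝ} (ht : 0 ≤ t) :
    cthickening t K = K + closedBall 0 t := by
  rw [hK.add_closedBall_zero ht]

theorem ar_zon_le (l : List Plane) {K : Set Plane} (hK : IsCompact K) {R t : ℝ} (ht : 0 ≤ t)
    (hR0 : 0 ≤ R) (hR : ∀ w, hz l w ≤ R * ‖w‖) :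
    ar (K + t • zon l) ≤ ar (cthickening (t * R) K) := by
  rw [← ar_translate (K + t • zon l) (t • cz l)]
  apply ar_mono _ hK.cthickening
  rintro x ⟨k, hk, _, ⟨z, hz, rfl⟩, h⟩
  have hz' := zon_sub_ball l hR hz
  rw [mem_closedBall, dist_eq_norm] at hz'
  rw [cthickening_eq_add hK (mul_nonneg ht hR0)]
  refine ⟨k, hk, t • (z - cz l), ?_, ?_⟩
  · rw [mem_closedBall_zero_iff, norm_smul, Real.norm_eq_abs, abs_of_nonneg ht]
    exact mul_le_mul_of_nonneg_left hz' ht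
  · simp only at h ⊢
    rw [smul_sub, ← add_sub_assoc, h]
    abel

theorem ar_le_zon (l : List Plane) {K : Set Plane} (hK : IsCompact K) {r t : ℝ} (ht : 0 < t)
    (hr0 : 0 ≤ r) (hr : ∀ w, r * ‖w‖ ≤ hz l w) :
    ar (cthickening (t * r) K) ≤ ar (K + t • zon l) := by
  rw [← ar_translate (K + t • zon l) (t • cz l)]
  apply ENNReal.toReal_mono
  · rw [measure_preimage_add]
    exact (hK.add ((zon_compact l).smul t)).measure_ne_top
  apply measure_mono
  rw [cthickening_eq_add hK (mul_nonneg ht.le hr0)]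
  rintro _ ⟨k, hk, y, hy, rfl⟩
  rw [mem_closedBall_zero_iff] at hy
  refine ⟨k, hk, t • (cz l + t⁻¹ • y), ⟨_, ball_sub_zon l hr ?_, rfl⟩, ?_⟩
  · rw [mem_closedBall, dist_eq_norm, add_sub_cancel_left, norm_smul, norm_inv, Real.norm_eq_abs,
      abs_of_pos ht, inv_mul_le_iff₀ ht]
    exact hy
  · simp only [smul_add, smul_inv_smul₀ ht.ne']
    abel

theorem main_real_aux {K : Set Plane} (hK : IsCompact K) (hc : IsConnected K) {δ ε τ : ℝ}
    (hδ : 0 < δ) (hε : 0 < ε) (hτ : 0 < τ) (hτ1 : τ < 1) :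
    ar (cthickening δ K) - ar K ≤ (δ / (1 - τ) + ε) * (1 + τ) *
      ((ar (cthickening ε K) - ar K) / ε + (δ / (1 - τ) + ε) * Real.pi) := by
  obtain ⟨l, hR, hr, hS⟩ := exists_zon hτ
  have hD := dz_le l hR
  rw [hS] at hD
  set η := ε / (1 + τ) with hη
  have hR0 : 0 < 1 + τ := by linarith
  have hr0 : 0 < 1 - τ := by linarith
  have hη0 : 0 < η := div_pos hε hR0
  obtain ⟨n, hn⟩ : ∃ n : ℕ, n = ⌈δ / (1 - τ) / η⌉₊ := ⟨_, rfl⟩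
  have hn1 : δ / (1 - τ) / η ≤ n := hn ▸ Nat.le_ceil _
  have hn2 : (n : ℝ) < δ / (1 - τ) / η + 1 := hn ▸ Nat.ceil_lt_add_one (by positivity)
  have hT1 : δ / (1 - τ) ≤ n * η := by rwa [div_le_iff₀ hη0] at hn1
  have hηε : η ≤ ε := by rw [hη, div_le_iff₀ hR0]; nlinarith
  have hT2 : n * η ≤ δ / (1 - τ) + ε := by
    have : n * η < (δ / (1 - τ) / η + 1) * η := mul_lt_mul_of_pos_right hn2 hη0
    rw [add_mul, div_mul_cancel₀ _ hη0.ne'] at this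
    linarith
  have hT0 : 0 < n * η := lt_of_lt_of_le (by positivity) hT1
  have h4 := zon_ineq4 l hη0.le hK hc n
  have h5 := ar_zon_le l hK hη0.le hR0.le hR
  have h6 := ar_le_zon l hK hT0 hr0.le hr
  have e1 : η * (1 + τ) = ε := by rw [hη, div_mul_cancel₀ _ hR0.ne']
  rw [e1] at h5
  have h7 : ar (cthickening δ K) ≤ ar (cthickening (n * η * (1 - τ)) K) := by
    apply ar_mono _ hK.cthickening
    apply cthickening_mono
    rwa [div_le_iff₀ hr0] at hT1
  have hV : 0 ≤ ar (cthickening ε K) - ar K :=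
    sub_nonneg.2 (ar_mono (self_subset_cthickening K) hK.cthickening)
  set V := ar (cthickening ε K) - ar K
  set T := n * η
  have h8 : ar (cthickening δ K) - ar K ≤ n * V + T ^ 2 * ((1 + τ) * Real.pi) := by
    have a1 : (n : ℝ) * (ar (K + η • zon l) - ar K) ≤ n * V :=
      mul_le_mul_of_nonneg_left (by simp only [V]; linarith) n.cast_nonneg
    have a2 : T ^ 2 * (dz l / 2) ≤ T ^ 2 * ((1 + τ) * Real.pi) :=
      mul_le_mul_of_nonneg_left hD (sq_nonneg _)
    linarith
  have e2 : n * V + T ^ 2 * ((1 + τ) * Real.pi) = T * (1 + τ) * (V / ε + T * Real.pi) := by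
    have : (n : ℝ) = T * (1 + τ) / ε := by
      rw [← e1]; simp only [T]; field_simp
    rw [this]
    field_simp
  rw [e2] at h8
  have hpi := Real.pi_pos
  have hVe : 0 ≤ V / ε := div_nonneg hV hε.le
  refine h8.trans ?_
  gcongr

theorem main_real {K : Set Plane} (hK : IsCompact K) (hc : IsConnected K) {δ ε : ℝ}
    (hδ : 0 < δ) (hε : 0 < ε) :
    ar (cthickening δ K) - ar K ≤ (δ + ε) *
      ((ar (cthickening ε K) - ar K) / ε + (δ + ε) * Real.pi) := by
  have hcont : Tendsto (fun τ : ℝ => (δ / (1 - τ) + ε) * (1 + τ) *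
      ((ar (cthickening ε K) - ar K) / ε + (δ / (1 - τ) + ε) * Real.pi)) (𝓝[>] 0)
      (𝓝 ((δ / (1 - 0) + ε) * (1 + 0) *
      ((ar (cthickening ε K) - ar K) / ε + (δ / (1 - 0) + ε) * Real.pi))) := by
    apply tendsto_nhdsWithin_of_tendsto_nhds
    have h1 : ContinuousAt (fun τ : ℝ => δ / (1 - τ)) 0 := by
      apply ContinuousAt.div <;> first | fun_prop | norm_num
    have : ContinuousAt (fun τ : ℝ => (δ / (1 - τ) + ε) * (1 + τ) *
      ((ar (cthickening ε K) - ar K) / ε + (δ / (1 - τ) + ε) * Real.pi)) 0 := by fun_prop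
    exact this
  have := ge_of_tendsto hcont (b := ar (cthickening δ K) - ar K) ?_
  · simpa using this
  · filter_upwards [Ioo_mem_nhdsGT (zero_lt_one' ℝ)] with τ hτ
    exact main_real_aux hK hc hδ hε hτ.1 hτ.2

/-- For a compact connected `K ⊆ ℝ²`, the limit `lim_{ε→0⁺} L(K^ε \ K)/ε` exists
(possibly infinite) and equals `sup_{ε>0} [L(K^ε \ K)/ε − πε]`. -/
theorem stmt_3 (K : Set Plane) (hK : IsCompact K) (hKconn : IsConnected K) :
    Tendsto (fun ε : ℝ => volume (cthickening ε K \ K) / ENNReal.ofReal ε)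
      (𝓝[>] (0 : ℝ)) (𝓝 (SMsup K)) := by
  let V : ℝ → ℝ := fun ε => ar (cthickening ε K) - ar K
  have hvol : ∀ ε, volume (cthickening ε K \ K) = ENNReal.ofReal (V ε) := by
    intro ε
    have f1 := (hK.cthickening (r := ε)).measure_ne_top (μ := volume)
    have f0 := hK.measure_ne_top (μ := volume)
    rw [measure_sdiff (self_subset_cthickening K) hK.measurableSet.nullMeasurableSet f0]
    simp only [V, ar]
    rw [ENNReal.ofReal_sub _ ENNReal.toReal_nonneg, ENNReal.ofReal_toReal f1,
      ENNReal.ofReal_toReal f0]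
  have hq : ∀ ε, 0 < ε → volume (cthickening ε K \ K) / ENNReal.ofReal ε
      = ENNReal.ofReal (V ε / ε) := by
    intro ε hε
    rw [hvol, ENNReal.ofReal_div_of_pos hε]
  refine tendsto_of_le_liminf_of_limsup_le ?_ ?_
  · apply iSup₂_le
    intro δ hδ
    have hδ : 0 < δ := hδ
    rw [hq δ hδ, ← ENNReal.ofReal_sub _ (by positivity)]
    have hlim : Tendsto (fun ε : ℝ => ENNReal.ofReal (V δ / (δ + ε) - (δ + ε) * Real.pi)) (𝓝[>] 0)
        (𝓝 (ENNReal.ofReal (V δ / δ - Real.pi * δ))) := by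
      apply ENNReal.tendsto_ofReal
      apply tendsto_nhdsWithin_of_tendsto_nhds
      have : ContinuousAt (fun ε : ℝ => V δ / (δ + ε) - (δ + ε) * Real.pi) 0 := by
        apply ContinuousAt.sub
        · apply ContinuousAt.div
          · fun_prop
          · fun_prop
          · simpa using hδ.ne'
        · fun_prop
      have h := this.tendsto
      simpa [mul_comm] using h
    rw [← hlim.liminf_eq]
    refine liminf_le_liminf ?_
    filter_upwards [self_mem_nhdsWithin] with ε hε
    have hε : 0 < ε := hε
    rw [hq ε hε]
    apply ENNReal.ofReal_le_ofReal
    have h := main_real hK hKconn hδ hε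
    have hp : 0 < δ + ε := by linarith
    rw [mul_comm, ← div_le_iff₀ hp] at h
    simp only [V]
    linarith
  · have hlim : Tendsto (fun ε : ℝ => SMsup K + ENNReal.ofReal (Real.pi * ε)) (𝓝[>] 0)
        (𝓝 (SMsup K + 0)) := by
      apply Tendsto.add tendsto_const_nhds
      apply tendsto_nhdsWithin_of_tendsto_nhds
      have : Continuous (fun ε : ℝ => ENNReal.ofReal (Real.pi * ε)) :=
        ENNReal.continuous_ofReal.comp (by fun_prop)
      simpa using this.tendsto 0
    rw [add_zero] at hlim
    rw [← hlim.limsup_eq]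
    refine limsup_le_limsup ?_
    filter_upwards [self_mem_nhdsWithin] with ε hε
    have h : volume (cthickening ε K \ K) / ENNReal.ofReal ε - ENNReal.ofReal (Real.pi * ε)
      ≤ SMsup K := le_iSup₂ (f := fun ε (_ : ε ∈ Set.Ioi (0 : ℝ)) =>
        volume (cthickening ε K \ K) / ENNReal.ofReal ε - ENNReal.ofReal (Real.pi * ε)) ε hε
    exact tsub_le_iff_right.1 h
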